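/- (Reduction Lemma II) Let x ∈ M_ℤ be projective. Then there exist g in the subgroup generated by {φ(C), ψ(D), τ : C, D ∈ J_ℤ} ∪ {T(P,Q) : P, Q ∈ GL₃(ℤ), det(P) = det(Q)} ∪ {T(t)}, an integer ε ∈ {0,1}, and k ∈ ℤ such that g(x) = (1, ε, diag(1,1,k), 0). Moreover 4k + ε² = q'(x), so ε and k are uniquely determined by q'(x). -/

import Mathlib

open Matrix

namespace FreudenthalZ

/-- The integral cubic Jordan algebra `J_ℤ = M₃(ℤ)`. -/
abbrev MatZ := Matrix (Fin 3) (Fin 3) ℤ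

/-- The trace bilinear form `(A, B) = tr(A·B)`. -/
def tb (A B : MatZ) : ℤ := (A * B).trace

/-- The Freudenthal cross product `A × B = (A+B)# − A# − B#` (adjoint = adjugate). -/
def cross (A B : MatZ) : MatZ := (A + B).adjugate - A.adjugate - B.adjugate

/-- The integral Freudenthal module `M_ℤ = ℤ ⊕ ℤ ⊕ J_ℤ ⊕ J_ℤ`, elements `(α, β, A, B)`. -/
abbrev MZ := ℤ × ℤ × MatZ × MatZ

/-- The quartic norm `q'(x) = ((A,B) − αβ)² − 4(A#,B#) + 4α·det A + 4β·det B`. -/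
def qz (x : MZ) : ℤ :=
  (tb x.2.2.1 x.2.2.2 - x.1 * x.2.1) ^ 2 - 4 * tb x.2.2.1.adjugate x.2.2.2.adjugate
    + 4 * x.1 * x.2.2.1.det + 4 * x.2.1 * x.2.2.2.det

/-- The symplectic form `{x, y} = αδ − βγ + (A,D) − (B,C)`. -/
def symp (x y : MZ) : ℤ :=
  x.1 * y.2.1 - x.2.1 * y.1 + tb x.2.2.1 y.2.2.2 - tb x.2.2.2 y.2.2.1

/-- Membership in the group `G_ℤ`: `ℤ`-linear automorphisms of `M_ℤ`
preserving the quartic norm `q'` and the symplectic form `{·,·}`. -/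
def InG (g : MZ → MZ) : Prop :=
  IsLinearMap ℤ g ∧ Function.Bijective g ∧
    (∀ x, qz (g x) = qz x) ∧ (∀ x y, symp (g x) (g y) = symp x y)

/-- `x` is projective: some `g ∈ G_ℤ` maps `x` to a diagonal reduced element
`(α, β, diag(a₁,a₂,a₃), 0)` (`α > 0`, `α ∣ β`, `α ∣ aᵢ`) satisfying the three gcd
conditions `gcd(α·aᵢ, α·β, aⱼ·a_k) = 1`. -/
def Projective (x : MZ) : Prop :=
  ∃ g : MZ → MZ, InG g ∧ ∃ α β a₁ a₂ a₃ : ℤ,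
    g x = (α, β, Matrix.diagonal ![a₁, a₂, a₃], 0) ∧
    0 < α ∧ α ∣ β ∧ α ∣ a₁ ∧ α ∣ a₂ ∧ α ∣ a₃ ∧
    Int.gcd (Int.gcd (α * a₁) (α * β)) (a₂ * a₃) = 1 ∧
    Int.gcd (Int.gcd (α * a₂) (α * β)) (a₃ * a₁) = 1 ∧
    Int.gcd (Int.gcd (α * a₃) (α * β)) (a₁ * a₂) = 1

end FreudenthalZ

open FreudenthalZ

namespace FreudenthalZ

/-- The elementary transformation
`φ(C) : (α,β,A,B) ↦ (α + (B,C) + (A,C#) + β·det C, β, A + βC, B + A×C + βC#)`. -/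
def phiMap (C : MatZ) (x : MZ) : MZ :=
  (x.1 + tb x.2.2.2 C + tb x.2.2.1 C.adjugate + x.2.1 * C.det,
   x.2.1,
   x.2.2.1 + x.2.1 • C,
   x.2.2.2 + cross x.2.2.1 C + x.2.1 • C.adjugate)

/-- The elementary transformation
`ψ(D) : (α,β,A,B) ↦ (α, β + (A,D) + (B,D#) + α·det D, A + B×D + αD#, B + αD)`. -/
def psiMap (D : MatZ) (x : MZ) : MZ :=
  (x.1,
   x.2.1 + tb x.2.2.1 D + tb x.2.2.2 D.adjugate + x.1 * D.det,
   x.2.2.1 + cross x.2.2.2 D + x.1 • D.adjugate,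
   x.2.2.2 + x.1 • D)

/-- The elementary transformation `τ : (α,β,A,B) ↦ (−β, α, −B, A)`. -/
def tauMap (x : MZ) : MZ := (-x.2.1, x.1, -x.2.2.2, x.2.2.1)

/-- The elementary transformation
`T(P,Q) : (α,β,A,B) ↦ (ε·α, ε·β, P A Q⁻¹, Q B P⁻¹)` with `ε = det P · det Q`. -/
def Tmap (P Q : GL (Fin 3) ℤ) (x : MZ) : MZ :=
  ((P : MatZ).det * (Q : MatZ).det * x.1,
   (P : MatZ).det * (Q : MatZ).det * x.2.1,
   (P : MatZ) * x.2.2.1 * ((Q⁻¹ : GL (Fin 3) ℤ) : MatZ),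
   (Q : MatZ) * x.2.2.2 * ((P⁻¹ : GL (Fin 3) ℤ) : MatZ))

/-- The elementary transformation `T(t) : (α,β,A,B) ↦ (α, β, Aᵀ, Bᵀ)`. -/
def Ttr (x : MZ) : MZ := (x.1, x.2.1, x.2.2.1ᵀ, x.2.2.2ᵀ)

/-- An element of `M_ℤ` is diagonal reduced if it has the form
`(α, β, diag(a₁,a₂,a₃), 0)` with `α > 0`, `α ∣ β` and `α ∣ aᵢ`. -/
def DiagReduced (x : MZ) : Prop :=
  ∃ α β a₁ a₂ a₃ : ℤ, x = (α, β, Matrix.diagonal ![a₁, a₂, a₃], 0) ∧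
    0 < α ∧ α ∣ β ∧ α ∣ a₁ ∧ α ∣ a₂ ∧ α ∣ a₃

/-- Finite products of the elementary transformations `φ(C)`, `ψ(D)`, `τ`,
`T(P,Q)` (with `det P = det Q`) and `T(t)`. -/
inductive ZWord : (MZ → MZ) → Prop
  | phi (C : MatZ) : ZWord (phiMap C)
  | psi (D : MatZ) : ZWord (psiMap D)
  | tau : ZWord tauMap
  | tmap (P Q : GL (Fin 3) ℤ) (h : (P : MatZ).det = (Q : MatZ).det) : ZWord (Tmap P Q)
  | ttr : ZWord Ttr
  | comp {g h : MZ → MZ} : ZWord g → ZWord h → ZWord (g ∘ h)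

end FreudenthalZ


namespace FreudenthalZ

theorem tb_eq (A B : MatZ) : tb A B =
    A 0 0 * B 0 0 + A 0 1 * B 1 0 + A 0 2 * B 2 0 + (A 1 0 * B 0 1 + A 1 1 * B 1 1 + A 1 2 * B 2 1)
    + (A 2 0 * B 0 2 + A 2 1 * B 1 2 + A 2 2 * B 2 2) := by
  simp [-zsmul_eq_mul, tb, Matrix.trace, Matrix.mul_apply, Fin.sum_univ_three]

theorem cross_eq (A B : MatZ) : cross A B =
    !![A 1 1 * B 2 2 + B 1 1 * A 2 2 - A 1 2 * B 2 1 - B 1 2 * A 2 1,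
       A 0 2 * B 2 1 + B 0 2 * A 2 1 - A 0 1 * B 2 2 - B 0 1 * A 2 2,
       A 0 1 * B 1 2 + B 0 1 * A 1 2 - A 0 2 * B 1 1 - B 0 2 * A 1 1;
       A 1 2 * B 2 0 + B 1 2 * A 2 0 - A 1 0 * B 2 2 - B 1 0 * A 2 2,
       A 0 0 * B 2 2 + B 0 0 * A 2 2 - A 0 2 * B 2 0 - B 0 2 * A 2 0,
       A 0 2 * B 1 0 + B 0 2 * A 1 0 - A 0 0 * B 1 2 - B 0 0 * A 1 2;
       A 1 0 * B 2 1 + B 1 0 * A 2 1 - A 1 1 * B 2 0 - B 1 1 * A 2 0,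
       A 0 1 * B 2 0 + B 0 1 * A 2 0 - A 0 0 * B 2 1 - B 0 0 * A 2 1,
       A 0 0 * B 1 1 + B 0 0 * A 1 1 - A 0 1 * B 1 0 - B 0 1 * A 1 0] := by
  ext i j
  fin_cases i <;> fin_cases j <;>
    simp [-zsmul_eq_mul, cross, Matrix.adjugate_fin_three] <;> ring

theorem phi_add (C C' : MatZ) (x : MZ) : phiMap C (phiMap C' x) = phiMap (C' + C) x := by
  obtain ⟨α, β, A, B⟩ := x
  refine Prod.ext ?_ (Prod.ext rfl (Prod.ext ?_ ?_))
  · simp [-zsmul_eq_mul, phiMap, tb_eq, cross_eq, Matrix.adjugate_fin_three, Matrix.det_fin_three]; ring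
  · simp [-zsmul_eq_mul, phiMap, add_assoc]
  · ext i j
    fin_cases i <;> fin_cases j <;>
      simp [-zsmul_eq_mul, phiMap, cross_eq, Matrix.adjugate_fin_three] <;> ring

theorem phi_zero (x : MZ) : phiMap 0 x = x := by
  obtain ⟨α, β, A, B⟩ := x
  refine Prod.ext ?_ (Prod.ext rfl (Prod.ext ?_ ?_))
  · simp [-zsmul_eq_mul, phiMap, tb_eq, Matrix.adjugate_fin_three, Matrix.det_fin_three]
  · simp [-zsmul_eq_mul, phiMap]
  · ext i j
    fin_cases i <;> fin_cases j <;>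
      simp [-zsmul_eq_mul, phiMap, cross_eq, Matrix.adjugate_fin_three]

theorem phi_lin (C : MatZ) : IsLinearMap ℤ (phiMap C) := by
  constructor
  · rintro ⟨α, β, A, B⟩ ⟨α', β', A', B'⟩
    refine Prod.ext ?_ (Prod.ext rfl (Prod.ext ?_ ?_))
    · simp [-zsmul_eq_mul, phiMap, tb_eq]; ring
    · simp [-zsmul_eq_mul, phiMap, add_smul]; abel
    · ext i j
      fin_cases i <;> fin_cases j <;>
        simp [-zsmul_eq_mul, phiMap, cross_eq] <;> ring
  · rintro c ⟨α, β, A, B⟩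
    refine Prod.ext ?_ (Prod.ext rfl (Prod.ext ?_ ?_))
    · simp [-zsmul_eq_mul, phiMap, tb_eq]; ring
    · simp [-zsmul_eq_mul, phiMap, mul_smul]
    · ext i j
      fin_cases i <;> fin_cases j <;>
        simp [-zsmul_eq_mul, phiMap, cross_eq] <;> ring

theorem phi_bij (C : MatZ) : Function.Bijective (phiMap C) := by
  refine Function.bijective_iff_has_inverse.mpr ⟨phiMap (-C), fun x => ?_, fun x => ?_⟩ <;>
    rw [phi_add] <;> simp [-zsmul_eq_mul, phi_zero]

theorem symp_phi (C : MatZ) (x y : MZ) : symp (phiMap C x) (phiMap C y) = symp x y := by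
  obtain ⟨α, β, A, B⟩ := x
  obtain ⟨α', β', A', B'⟩ := y
  simp [-zsmul_eq_mul, symp, phiMap, tb_eq, cross_eq, Matrix.adjugate_fin_three, Matrix.det_fin_three]; ring

theorem qz_phi_single (i j : Fin 3) (n : ℤ) (x : MZ) :
    qz (phiMap (Matrix.single i j n) x) = qz x := by
  obtain ⟨α, β, A, B⟩ := x
  fin_cases i <;> fin_cases j <;>
    simp [-zsmul_eq_mul, qz, phiMap, tb_eq, cross_eq, Matrix.adjugate_fin_three, Matrix.det_fin_three,
      Matrix.single_apply] <;> ring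

end FreudenthalZ

namespace FreudenthalZ

theorem InG.comp {g h : MZ → MZ} (hg : InG g) (hh : InG h) : InG (g ∘ h) := by
  obtain ⟨⟨a1, a2⟩, b, c, d⟩ := hg
  obtain ⟨⟨a1', a2'⟩, b', c', d'⟩ := hh
  refine ⟨⟨fun x y => ?_, fun n x => ?_⟩, b.comp b', fun x => ?_, fun x y => ?_⟩
  · simp [a1, a1']
  · simp only [Function.comp, a2, a2']
  · simp [c, c']
  · simp only [d', d, Function.comp]

/-- `y` is obtained from `x` by an elementary word which lies in `G_ℤ`. -/
def Reach (x y : MZ) : Prop := ∃ g, ZWord g ∧ InG g ∧ g x = y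

theorem Reach.trans {x y z : MZ} (h : Reach x y) (h' : Reach y z) : Reach x z := by
  obtain ⟨g, hg, hg', rfl⟩ := h
  obtain ⟨k, hk, hk', rfl⟩ := h'
  exact ⟨k ∘ g, .comp hk hg, hk'.comp hg', rfl⟩

theorem phi_single_inG (i j : Fin 3) (n : ℤ) : InG (phiMap (Matrix.single i j n)) :=
  ⟨phi_lin _, phi_bij _, qz_phi_single i j n, symp_phi _⟩

theorem phi_zero' : phiMap 0 = id := funext phi_zero

theorem Reach.refl (x : MZ) : Reach x x := by
  refine ⟨phiMap 0, .phi 0, ?_, phi_zero x⟩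
  have := phi_single_inG 0 0 0
  simpa using this

theorem phi_inG (C : MatZ) : InG (phiMap C) := by
  have hadd : ∀ C C' : MatZ, InG (phiMap C) → InG (phiMap C') → InG (phiMap (C + C')) := by
    intro C C' h h'
    have : phiMap (C + C') = phiMap C' ∘ phiMap C := by
      funext x; simp [phi_add]
    rw [this]; exact h'.comp h
  have h0 : InG (phiMap 0) := by simpa using phi_single_inG 0 0 0
  rw [Matrix.matrix_eq_sum_single C]
  simp only [Fin.sum_univ_three]
  have row : ∀ i, InG (phiMap (Matrix.single i 0 (C i 0) + Matrix.single i 1 (C i 1)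
      + Matrix.single i 2 (C i 2))) := fun i =>
    hadd _ _ (hadd _ _ (phi_single_inG _ _ _) (phi_single_inG _ _ _)) (phi_single_inG _ _ _)
  exact hadd _ _ (hadd _ _ (row 0) (row 1)) (row 2)

theorem tau_inG : InG tauMap := by
  refine ⟨⟨?_, ?_⟩, ?_, ?_, ?_⟩
  · rintro ⟨α, β, A, B⟩ ⟨α', β', A', B'⟩
    simp [tauMap]; constructor <;> abel
  · rintro n ⟨α, β, A, B⟩
    simp [-zsmul_eq_mul, tauMap]
  · refine Function.bijective_iff_has_inverse.mpr
      ⟨fun x => (x.2.1, -x.1, x.2.2.2, -x.2.2.1), fun x => ?_, fun x => ?_⟩ <;> simp [tauMap]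
  · rintro ⟨α, β, A, B⟩
    simp [qz, tauMap, tb_eq, Matrix.adjugate_fin_three, Matrix.det_fin_three]; ring
  · rintro ⟨α, β, A, B⟩ ⟨α', β', A', B'⟩
    simp [symp, tauMap, tb_eq]; ring

theorem psi_eq (D : MatZ) : psiMap D = tauMap ∘ tauMap ∘ tauMap ∘ phiMap (-D) ∘ tauMap := by
  funext ⟨α, β, A, B⟩
  refine Prod.ext ?_ (Prod.ext ?_ (Prod.ext ?_ ?_))
  · simp [psiMap, phiMap, tauMap]
  · simp [psiMap, phiMap, tauMap, tb_eq, Matrix.adjugate_fin_three, Matrix.det_fin_three]; ring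
  · ext i j
    fin_cases i <;> fin_cases j <;>
      simp [-zsmul_eq_mul, psiMap, phiMap, tauMap, cross_eq, Matrix.adjugate_fin_three] <;> ring
  · simp [psiMap, phiMap, tauMap]; abel

theorem psi_inG (D : MatZ) : InG (psiMap D) := by
  rw [psi_eq]
  exact tau_inG.comp (tau_inG.comp (tau_inG.comp ((phi_inG _).comp tau_inG)))

theorem reach_phi (C : MatZ) (x : MZ) : Reach x (phiMap C x) := ⟨_, .phi C, phi_inG C, rfl⟩
theorem reach_psi (C : MatZ) (x : MZ) : Reach x (psiMap C x) := ⟨_, .psi C, psi_inG C, rfl⟩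
theorem reach_tau (x : MZ) : Reach x (tauMap x) := ⟨_, .tau, tau_inG, rfl⟩

theorem tmap_inG (P Q : GL (Fin 3) ℤ) (hP : (P : MatZ).det = 1) (hQ : (Q : MatZ).det = 1) :
    InG (Tmap P Q) := by
  have hPi : ((P⁻¹ : GL (Fin 3) ℤ) : MatZ) * (P : MatZ) = 1 := by
    rw [← Units.val_mul]; simp
  have hPi' : (P : MatZ) * ((P⁻¹ : GL (Fin 3) ℤ) : MatZ) = 1 := by
    rw [← Units.val_mul]; simp
  have hQi : ((Q⁻¹ : GL (Fin 3) ℤ) : MatZ) * (Q : MatZ) = 1 := by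
    rw [← Units.val_mul]; simp
  have hQi' : (Q : MatZ) * ((Q⁻¹ : GL (Fin 3) ℤ) : MatZ) = 1 := by
    rw [← Units.val_mul]; simp
  unfold Tmap
  generalize ((P⁻¹ : GL (Fin 3) ℤ) : MatZ) = P' at *
  generalize ((Q⁻¹ : GL (Fin 3) ℤ) : MatZ) = Q' at *
  generalize (P : MatZ) = P at *
  generalize (Q : MatZ) = Q at *
  have dP : P'.det = 1 := by
    have := congrArg Matrix.det hPi; simpa [hP] using this
  have dQ : Q'.det = 1 := by
    have := congrArg Matrix.det hQi; simpa [hQ] using this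
  have key : ∀ P P' Q Q' A B : MatZ, P' * P = 1 → Q' * Q = 1 →
      tb (P * A * Q') (Q * B * P') = tb A B := by
    intro P P' Q Q' A B h h'
    unfold tb
    have : P * A * Q' * (Q * B * P') = P * (A * (Q' * Q) * B) * P' := by
      simp only [Matrix.mul_assoc]
    rw [this, h', Matrix.mul_one, Matrix.trace_mul_comm, ← Matrix.mul_assoc, h, Matrix.one_mul]
  simp only [hP, hQ, one_mul]
  refine ⟨⟨?_, ?_⟩, ?_, ?_, ?_⟩
  · rintro ⟨α, β, A, B⟩ ⟨α', β', A', B'⟩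
    simp [Matrix.mul_add, Matrix.add_mul]
  · rintro n ⟨α, β, A, B⟩
    simp [-zsmul_eq_mul]
  · refine Function.bijective_iff_has_inverse.mpr
      ⟨fun x => (x.1, x.2.1, P' * x.2.2.1 * Q, Q' * x.2.2.2 * P), ?_, ?_⟩
    · rintro ⟨α, β, A, B⟩
      have e1 : P' * (P * A * Q') * Q = (P' * P) * A * (Q' * Q) := by
        simp only [Matrix.mul_assoc]
      have e2 : Q' * (Q * B * P') * P = (Q' * Q) * B * (P' * P) := by
        simp only [Matrix.mul_assoc]
      simp [e1, e2, hPi, hQi]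
    · rintro ⟨α, β, A, B⟩
      have e1 : P * (P' * A * Q) * Q' = (P * P') * A * (Q * Q') := by
        simp only [Matrix.mul_assoc]
      have e2 : Q * (Q' * B * P) * P' = (Q * Q') * B * (P * P') := by
        simp only [Matrix.mul_assoc]
      simp [e1, e2, hPi', hQi']
  · rintro ⟨α, β, A, B⟩
    have k1 := key P P' Q Q' A B hPi hQi
    have k2 := key Q'.adjugate Q.adjugate P'.adjugate P.adjugate A.adjugate B.adjugate
      (by rw [← Matrix.adjugate_mul_distrib, hQi]; simp)
      (by rw [← Matrix.adjugate_mul_distrib, hPi]; simp)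
    simp only [qz, k1, Matrix.adjugate_mul_distrib, ← Matrix.mul_assoc] at k2 ⊢
    rw [k2]
    simp [hP, hQ, dP, dQ]
  · rintro ⟨α, β, A, B⟩ ⟨α', β', A', B'⟩
    simp [symp, key _ _ _ _ _ _ hPi hQi, key _ _ _ _ _ _ hQi hPi]

theorem reach_mul (P Q : MatZ) (hP : P.det = 1) (hQ : Q.det = 1) (α β : ℤ) (A : MatZ) :
    Reach (α, β, A, 0) (α, β, P * A * Q, 0) := by
  let P' : GL (Fin 3) ℤ := Matrix.GeneralLinearGroup.mk'' P (by simp [hP])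
  let Q' : GL (Fin 3) ℤ := Matrix.GeneralLinearGroup.mk'' Q (by simp [hQ])
  have hP' : (P' : MatZ) = P := rfl
  have hQ' : (Q' : MatZ) = Q := rfl
  have d : ((Q'⁻¹ : GL (Fin 3) ℤ) : MatZ).det = 1 := by
    have : ((Q'⁻¹ : GL (Fin 3) ℤ) : MatZ) * (Q' : MatZ) = 1 := by
      rw [← Units.val_mul]; simp
    have := congrArg Matrix.det this
    simpa [-Matrix.coe_units_inv, hQ', hQ] using this
  refine ⟨Tmap P' Q'⁻¹, .tmap _ _ (by rw [hP', hP, d]), tmap_inG _ _ (by rw [hP', hP]) d, ?_⟩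
  simp only [Tmap, hP', hP, d, inv_inv, hQ']
  simp

theorem reach_row (i j : Fin 3) (h : i ≠ j) (n α β : ℤ) (A : MatZ) :
    Reach (α, β, A, 0) (α, β, Matrix.transvection i j n * A, 0) := by
  simpa using reach_mul (Matrix.transvection i j n) 1
    (Matrix.det_transvection_of_ne i j h n) (by simp) α β A

theorem reach_col (i j : Fin 3) (h : i ≠ j) (n α β : ℤ) (A : MatZ) :
    Reach (α, β, A, 0) (α, β, A * Matrix.transvection i j n, 0) := by
  simpa using reach_mul 1 (Matrix.transvection i j n) 
    (by simp) (Matrix.det_transvection_of_ne i j h n) α β A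

/-- The basic move on elements `(1, β, A, 0)`. -/
theorem reach_move (n β : ℤ) (A : MatZ) :
    Reach (1, β, A, 0) (1, β - 2 * (n * (A 0 0 * A 1 1 - A 0 1 * A 1 0)),
      A + Matrix.single 2 2 ((β - n * (A 0 0 * A 1 1 - A 0 1 * A 1 0)) * n), 0) := by
  refine (reach_phi (Matrix.single 2 2 n) _).trans ?_
  convert reach_psi (-cross A (Matrix.single 2 2 n)) _ using 1
  refine Prod.ext ?_ (Prod.ext ?_ (Prod.ext ?_ ?_))
  · simp [psiMap, phiMap, tb_eq, Matrix.adjugate_fin_three, Matrix.det_fin_three]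
  · simp [psiMap, phiMap, cross_eq, tb_eq, Matrix.adjugate_fin_three, Matrix.det_fin_three]; ring
  · ext i j
    fin_cases i <;> fin_cases j <;>
      simp [-zsmul_eq_mul, psiMap, phiMap, cross_eq, tb_eq, Matrix.adjugate_fin_three,
        Matrix.det_fin_three] <;> ring
  · ext i j
    fin_cases i <;> fin_cases j <;>
      simp [-zsmul_eq_mul, psiMap, phiMap, cross_eq, tb_eq, Matrix.adjugate_fin_three,
        Matrix.det_fin_three] <;> ring

end FreudenthalZ

namespace FreudenthalZ

/-- Euclid's algorithm by elementary moves on pairs. -/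
theorem euclid (S : ℤ → ℤ → Prop) (h1 : ∀ a b n, S a b → S (a + n * b) b)
    (h2 : ∀ a b n, S a b → S a (b + n * a)) :
    ∀ (N : ℕ) (a b : ℤ), b.natAbs ≤ N → S a b → ∃ g b', S g b' ∧ g ∣ a ∧ g ∣ b := by
  intro N
  induction N with
  | zero =>
    intro a b hb hS
    have : b = 0 := by omega
    subst this
    exact ⟨a, 0, hS, dvd_rfl, dvd_zero _⟩
  | succ N ih =>
    intro a b hb hS
    by_cases hb0 : b = 0
    · subst hb0
      exact ⟨a, 0, hS, dvd_rfl, dvd_zero _⟩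
    have e : a + (-(a / b)) * b = a % b := by
      have := Int.mul_ediv_add_emod a b; linarith
    have hS1 : S (a % b) b := by
      have := h1 a b (-(a / b)) hS; rwa [e] at this
    by_cases hr : a % b = 0
    · rw [hr] at hS1
      refine ⟨b, b, ?_, Int.dvd_of_emod_eq_zero hr, dvd_rfl⟩
      simpa using h1 0 b 1 hS1
    have e2 : b + (-(b / (a % b))) * (a % b) = b % (a % b) := by
      have := Int.mul_ediv_add_emod b (a % b); linarith
    have hS2 : S (a % b) (b % (a % b)) := by
      have := h2 (a % b) b (-(b / (a % b))) hS1; rwa [e2] at this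
    have l1 : 0 ≤ a % b := Int.emod_nonneg _ hb0
    have l2 : a % b < |b| := Int.emod_lt_abs _ hb0
    have l3 : 0 ≤ b % (a % b) := Int.emod_nonneg _ hr
    have l4 : b % (a % b) < a % b := Int.emod_lt_of_pos _ (by omega)
    have l5 := Int.abs_eq_natAbs b
    have l6 : ((b % (a % b)).natAbs : ℤ) = b % (a % b) := Int.natAbs_of_nonneg l3
    obtain ⟨g, b', hg, d1, d2⟩ := ih (a % b) (b % (a % b)) (by omega) hS2
    have d3 : g ∣ b := by
      rw [← Int.mul_ediv_add_emod b (a % b)]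
      exact dvd_add (d1.mul_right _) d2
    refine ⟨g, b', hg, ?_, d3⟩
    rw [← Int.mul_ediv_add_emod a b]
    exact dvd_add (d3.mul_right _) d1

/-- Choice of an integer minimal for divisibility. -/
theorem exists_dvd_min (T : ℤ → Prop) (h : ∃ a, T a) :
    ∃ a, T a ∧ ∀ g, T g → g ∣ a → a ∣ g := by
  obtain ⟨a, ha⟩ := h
  obtain ⟨m, hm, hmin⟩ := (wellFounded_dvdNotUnit (α := ℤ)).has_min {a | T a} ⟨a, ha⟩
  refine ⟨m, hm, fun g hg hgm => ?_⟩
  by_contra hn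
  exact hmin g hg (dvdNotUnit_of_dvd_of_not_dvd hgm hn)

/-- Finite difference expression giving `12` times the linear coefficient of `q'`. -/
def fd (x y : MZ) : ℤ :=
  8 * (qz (x + y) - qz (x - y)) - (qz (x + (2 : ℤ) • y) - qz (x - (2 : ℤ) • y))

/-- The obstruction to projectivity at `p`. -/
def Bad (p : ℤ) (x : MZ) : Prop := ∃ c : ℤ, ∀ y, 48 * p ∣ fd x y - 24 * c * symp x y

theorem InG.sub {g : MZ → MZ} (hg : InG g) (x y : MZ) : g (x - y) = g x - g y :=
  (IsLinearMap.mk' g hg.1).map_sub x y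

theorem Bad.iff {g : MZ → MZ} (hg : InG g) (p : ℤ) (x : MZ) : Bad p (g x) ↔ Bad p x := by
  have key : ∀ y, fd (g x) (g y) = fd x y := by
    intro y
    simp only [fd]
    rw [← hg.1.map_smul, ← hg.1.map_add, ← hg.1.map_add, ← hg.sub, ← hg.sub]
    simp only [hg.2.2.1]
  unfold Bad
  refine exists_congr fun c => ?_
  constructor
  · intro h y
    have := h (g y)
    rwa [key, hg.2.2.2] at this
  · intro h y
    obtain ⟨y, rfl⟩ := hg.2.1.2 y
    rw [key, hg.2.2.2]
    exact h y

theorem fd_eq (β : ℤ) (A : MatZ) (γ δ : ℤ) (C D : MatZ) :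
    fd (1, β, A, 0) (γ, δ, C, D) = 24 * (β * (δ + β * γ - tb A D) + 2 * γ * A.det
      + 2 * tb A.adjugate C) := by
  simp [-zsmul_eq_mul, fd, qz, tb_eq, Matrix.adjugate_fin_three, Matrix.det_fin_three]
  ring

theorem bad_of (p β : ℤ) (A : MatZ) (h1 : p ∣ β) (h2 : ∀ i j, p ∣ A.adjugate i j)
    (h3 : p ∣ A.det) : Bad p (1, β, A, 0) := by
  refine ⟨β, ?_⟩
  rintro ⟨γ, δ, C, D⟩
  rw [fd_eq]
  have e : 24 * (β * (δ + β * γ - tb A D) + 2 * γ * A.det + 2 * tb A.adjugate C)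
      - 24 * β * symp (1, β, A, 0) (γ, δ, C, D)
      = 48 * (β * (β * γ - tb A D) + γ * A.det + tb A.adjugate C) := by
    have : tb 0 C = 0 := by simp [tb]
    simp only [symp, this]; ring
  rw [e]
  apply mul_dvd_mul_left
  refine dvd_add (dvd_add (h1.mul_right _) (h3.mul_left _)) ?_
  rw [tb_eq]
  repeat' apply dvd_add
  all_goals exact (h2 _ _).mul_right _

theorem of_bad (p β : ℤ) (hp : Prime p) (A : MatZ) (h : Bad p (1, β, A, 0)) :
    p ∣ β ∧ ∀ i j, p ∣ A.adjugate i j := by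
  obtain ⟨c, hc⟩ := h
  have t0 : ∀ C, tb 0 C = 0 := by simp [tb]
  have t0' : ∀ C, tb C 0 = 0 := by simp [tb]
  have hadj : ∀ i j, p ∣ A.adjugate i j := by
    intro i j
    have := hc (0, 0, Matrix.single j i 1, 0)
    rw [fd_eq] at this
    simp only [symp, t0, t0'] at this
    have e : tb A.adjugate (Matrix.single j i 1) = A.adjugate i j := by
      simp [tb, Matrix.trace_mul_single]
    rw [e] at this
    have h48 : 48 * p ∣ 48 * A.adjugate i j := by
      exact this.trans (dvd_of_eq (by ring))
    exact (mul_dvd_mul_iff_left (by norm_num)).mp h48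
  refine ⟨?_, hadj⟩
  have hdet : p ∣ A.det := by
    have h1 : p ∣ A.adjugate.det := by
      rw [Matrix.det_fin_three]
      have := hadj
      refine dvd_sub (dvd_add (dvd_add (dvd_sub (dvd_sub ?_ ?_) ?_) ?_) ?_) ?_ <;>
        exact (this _ _).mul_left _
    rw [Matrix.det_adjugate] at h1
    exact hp.dvd_of_dvd_pow h1
  have k1 := hc (0, 1, 0, 0)
  have k2 := hc (1, 0, 0, 0)
  rw [fd_eq] at k1 k2
  simp only [symp, t0, t0'] at k1 k2
  have k3 : 48 * p ∣ 48 * (β ^ 2 + A.det) := by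
    have e := dvd_add k2 (k1.mul_left β)
    exact e.trans (dvd_of_eq (by ring))
  have k4 := (mul_dvd_mul_iff_left (by norm_num)).mp k3
  exact hp.dvd_of_dvd_pow ((dvd_add_left hdet).mp k4)

end FreudenthalZ

namespace FreudenthalZ

theorem min_dvd (S : ℤ → ℤ → Prop) (h1 : ∀ a b n, S a b → S (a + n * b) b)
    (h2 : ∀ a b n, S a b → S a (b + n * a)) (a b : ℤ) (h : S a b)
    (hmin : ∀ g b', S g b' → g ∣ a → a ∣ g) : a ∣ b := by
  obtain ⟨g, b', hg, d1, d2⟩ := euclid S h1 h2 _ a b le_rfl h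
  exact (hmin g b' hg d1).trans d2

theorem exists_prime_of_not_unit (a : ℤ) (h : ¬ IsUnit a) : ∃ p : ℤ, Prime p ∧ p ∣ a :=
  Int.exists_prime_and_dvd (fun h' => h (Int.isUnit_iff_natAbs_eq.mpr h'))

theorem phi_single (i j : Fin 3) (n α β : ℤ) (A B : MatZ) :
    phiMap (Matrix.single j i n) (α, β, A, B) =
      (α + n * B i j, β, A + β • Matrix.single j i n, B + cross A (Matrix.single j i n)) := by
  have h1 : (Matrix.single j i n : MatZ).adjugate = 0 := by
    ext k l
    fin_cases i <;> fin_cases j <;> fin_cases k <;> fin_cases l <;>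
      simp [Matrix.adjugate_fin_three]
  have h2 : (Matrix.single j i n : MatZ).det = 0 := by
    fin_cases i <;> fin_cases j <;> simp [Matrix.det_fin_three]
  have h3 : tb B (Matrix.single j i n) = n * B i j := by
    simp [tb, Matrix.trace_mul_single, mul_comm]
  have h4 : tb A 0 = 0 := by simp [tb]
  simp [-zsmul_eq_mul, phiMap, h1, h2, h3, h4]

theorem cross_single (i j : Fin 3) (n : ℤ) (A : MatZ) :
    cross A (Matrix.single j i n) i j = 0 := by
  fin_cases i <;> fin_cases j <;> simp [cross_eq]

theorem cross_smul_left (a : ℤ) (A B : MatZ) : cross (a • A) B = a • cross A B := by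
  ext i j
  fin_cases i <;> fin_cases j <;> simp [-zsmul_eq_mul, cross_eq] <;> ring

theorem prim_of_reach {x y : MZ} (h : Reach x y) (p : ℤ) (hy : ∃ w : MZ, y = p • w) :
    ∃ w : MZ, x = p • w := by
  obtain ⟨g, -, hg, rfl⟩ := h
  obtain ⟨w, hw⟩ := hy
  obtain ⟨v, rfl⟩ := hg.2.1.2 w
  rw [← hg.1.map_smul] at hw
  exact ⟨v, hg.2.1.1 hw⟩

theorem step1 (x : MZ) (hx : ∀ p : ℤ, Prime p → ¬ ∃ w : MZ, x = p • w) :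
    ∃ β A, Reach x (1, β, A, 0) := by
  obtain ⟨a, ⟨y, hy, hya⟩, hmin⟩ := exists_dvd_min (fun a => ∃ y, Reach x y ∧ y.1 = a)
    ⟨x.1, x, .refl x, rfl⟩
  have HB : ∀ z, Reach x z → z.1 = a → ∀ i j, a ∣ z.2.2.2 i j := by
    intro z hz hza i j
    refine min_dvd (fun a b => ∃ z, Reach x z ∧ z.1 = a ∧ z.2.2.2 i j = b) ?_ ?_ a _
      ⟨z, hz, hza, rfl⟩ ?_
    · rintro a b n ⟨⟨α, β, A, B⟩, h, rfl, rfl⟩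
      refine ⟨_, h.trans (reach_phi (Matrix.single j i n) _), ?_⟩
      rw [phi_single]
      simp [cross_single]
    · rintro a b n ⟨⟨α, β, A, B⟩, h, rfl, rfl⟩
      refine ⟨_, h.trans (reach_psi (Matrix.single i j n) _), rfl, ?_⟩
      simp [-zsmul_eq_mul, psiMap, mul_comm]
    · rintro g b' ⟨z, hz, hzg, -⟩ hg
      exact hmin g ⟨z, hz, hzg⟩ hg
  have HA0 : ∀ β A, Reach x (a, β, A, 0) → ∀ i j, a ∣ A i j := by
    intro β A h i j
    have H : ∀ k l m n, a ∣ cross A (Matrix.single l k 1) m n := by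
      intro k l m n
      have := HB _ (h.trans (reach_phi (Matrix.single l k 1) _)) (by rw [phi_single]; simp) m n
      rw [phi_single] at this
      simpa using this
    have c00 := H 2 2 1 1
    have c01 := H 2 2 0 1
    have c02 := H 1 2 0 1
    have c10 := H 2 2 1 0
    have c11 := H 2 2 0 0
    have c12 := H 1 2 0 0
    have c20 := H 2 1 1 0
    have c21 := H 2 1 0 0
    have c22 := H 1 1 0 0
    simp [cross_eq] at c00 c01 c02 c10 c11 c12 c20 c21 c22
    fin_cases i <;> fin_cases j <;> assumption
  have HC : ∀ z, Reach x z → z.1 = a → ∃ D : MatZ, z.2.2.2 = a • D := by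
    intro z hz hza
    choose D hD using HB z hz hza
    exact ⟨Matrix.of D, by ext i j; simp [-zsmul_eq_mul, hD]⟩
  have Hpsi : ∀ β A (D : MatZ), psiMap (-D) (a, β, A, a • D) =
      (a, (psiMap (-D) (a, β, A, a • D)).2.1,
        A + a • (cross D (-D) + (-D).adjugate), 0) := by
    intro β A D
    refine Prod.ext rfl (Prod.ext rfl (Prod.ext ?_ ?_))
    · simp only [psiMap, cross_smul_left, smul_add, add_assoc]
    · simp [psiMap]
  have HA : ∀ z, Reach x z → z.1 = a → ∀ i j, a ∣ z.2.2.1 i j := by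
    intro z hz hza i j
    obtain ⟨D, hD⟩ := HC z hz hza
    obtain ⟨α, β, A, B⟩ := z
    simp only at hza hD
    subst hza hD
    have h := hz.trans (reach_psi (-D) _)
    rw [Hpsi] at h
    have := HA0 _ _ h i j
    rw [Matrix.add_apply, Matrix.smul_apply, smul_eq_mul] at this
    exact (dvd_add_left (dvd_mul_right _ _)).mp this
  obtain ⟨β, A, hr⟩ : ∃ β A, Reach x (a, β, A, 0) := by
    obtain ⟨D, hD⟩ := HC y hy hya
    obtain ⟨α, β, A, B⟩ := y
    simp only at hya hD
    subst hya hD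
    have h := hy.trans (reach_psi (-D) _)
    rw [Hpsi] at h
    exact ⟨_, _, h⟩
  have hA := HA0 β A hr
  have hβ : a ∣ β := by
    have := HA _ (hr.trans (reach_phi (Matrix.single 0 0 1) _)) (by rw [phi_single]; simp) 0 0
    rw [phi_single] at this
    simp only [Matrix.add_apply, Matrix.smul_apply, smul_eq_mul, Matrix.single_apply_same,
      mul_one] at this
    exact (dvd_add_right (hA 0 0)).mp this
  have hu : IsUnit a := by
    by_contra hn
    obtain ⟨p, hp, hpa⟩ := exists_prime_of_not_unit a hn
    refine hx p hp (prim_of_reach hr p ?_)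
    obtain ⟨a', rfl⟩ := hpa
    obtain ⟨β', rfl⟩ := (dvd_mul_right _ _).trans hβ
    choose A' hA' using fun i j => (dvd_mul_right p a').trans (hA i j)
    refine ⟨(a', β', Matrix.of A', 0), ?_⟩
    refine Prod.ext (by simp) (Prod.ext (by simp) (Prod.ext ?_ (by simp)))
    ext i j
    simp [-zsmul_eq_mul, hA']
  rcases Int.isUnit_iff.mp hu with rfl | rfl
  · exact ⟨β, A, hr⟩
  · refine ⟨-β, -A, (hr.trans (reach_tau _)).trans ?_⟩
    convert reach_tau _ using 1
    simp [tauMap]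

theorem dvd_adj (p : ℤ) (A : MatZ) (h : ∀ i j, p ∣ A i j) :
    (∀ i j, p ∣ A.adjugate i j) ∧ p ∣ A.det := by
  choose A' hA' using h
  have : A = p • Matrix.of A' := by ext i j; simp [-zsmul_eq_mul, hA']
  rw [this, Matrix.adjugate_smul, Matrix.det_smul]
  refine ⟨fun i j => ?_, ?_⟩
  · rw [Matrix.smul_apply, smul_eq_mul]
    exact (dvd_pow_self p (by simp)).mul_right _
  · exact (dvd_pow_self p (by simp)).mul_right _

theorem step2 (x : MZ) (hx : ∀ p : ℤ, Prime p → ¬ Bad p x) (h0 : ∃ β A, Reach x (1, β, A, 0)) :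
    ∃ β A, Reach x (1, β, A, 0) ∧ A 0 0 = 1 := by
  obtain ⟨β0, A0, h0⟩ := h0
  obtain ⟨a, ⟨β, A, hr, hA⟩, hmin⟩ := exists_dvd_min
    (fun a => ∃ β A, Reach x (1, β, A, 0) ∧ A 0 0 = a) ⟨A0 0 0, β0, A0, h0, rfl⟩
  have Hrow : ∀ β A, Reach x (1, β, A, 0) → A 0 0 = a → ∀ j, a ∣ A 0 j := by
    intro β A h hA j
    by_cases hj : j = 0
    · subst hj; rw [hA]
    refine min_dvd (fun a b => ∃ β A, Reach x (1, β, A, 0) ∧ A 0 0 = a ∧ A 0 j = b) ?_ ?_ a _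
      ⟨β, A, h, hA, rfl⟩ ?_
    · rintro a b n ⟨β, A, h, rfl, rfl⟩
      refine ⟨β, _, h.trans (reach_col j 0 hj n 1 β A), ?_, ?_⟩
      · rw [Matrix.mul_transvection_apply_same]
      · rw [Matrix.mul_transvection_apply_of_ne _ _ _ _ hj]
    · rintro a b n ⟨β, A, h, rfl, rfl⟩
      refine ⟨β, _, h.trans (reach_col 0 j (Ne.symm hj) n 1 β A), ?_, ?_⟩
      · rw [Matrix.mul_transvection_apply_of_ne _ _ _ _ (Ne.symm hj)]
      · rw [Matrix.mul_transvection_apply_same]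
    · rintro g b' ⟨β, A, h, hg, -⟩ hga
      exact hmin g ⟨β, A, h, hg⟩ hga
  have Hcol : ∀ β A, Reach x (1, β, A, 0) → A 0 0 = a → ∀ j, a ∣ A j 0 := by
    intro β A h hA j
    by_cases hj : j = 0
    · subst hj; rw [hA]
    refine min_dvd (fun a b => ∃ β A, Reach x (1, β, A, 0) ∧ A 0 0 = a ∧ A j 0 = b) ?_ ?_ a _
      ⟨β, A, h, hA, rfl⟩ ?_
    · rintro a b n ⟨β, A, h, rfl, rfl⟩
      refine ⟨β, _, h.trans (reach_row 0 j (Ne.symm hj) n 1 β A), ?_, ?_⟩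
      · rw [Matrix.transvection_mul_apply_same]
      · rw [Matrix.transvection_mul_apply_of_ne _ _ _ _ hj]
    · rintro a b n ⟨β, A, h, rfl, rfl⟩
      refine ⟨β, _, h.trans (reach_row j 0 hj n 1 β A), ?_, ?_⟩
      · rw [Matrix.transvection_mul_apply_of_ne _ _ _ _ (Ne.symm hj)]
      · rw [Matrix.transvection_mul_apply_same]
    · rintro g b' ⟨β, A, h, hg, -⟩ hga
      exact hmin g ⟨β, A, h, hg⟩ hga
  have Hall : ∀ β A, Reach x (1, β, A, 0) → A 0 0 = a → ∀ i j, a ∣ A i j := by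
    intro β A h hA i j
    by_cases hi : i = 0
    · subst hi; exact Hrow β A h hA j
    obtain ⟨c, hc⟩ := Hcol β A h hA i
    have h1 := h.trans (reach_row i 0 hi (-c) 1 β A)
    have h2 := h1.trans (reach_row 0 i (Ne.symm hi) 1 1 β _)
    have := Hrow β _ h2 (by
      rw [Matrix.transvection_mul_apply_same, Matrix.transvection_mul_apply_same,
        Matrix.transvection_mul_apply_of_ne _ _ _ _ (Ne.symm hi), hc, hA]; ring) j
    rw [Matrix.transvection_mul_apply_same, Matrix.transvection_mul_apply_same,
        Matrix.transvection_mul_apply_of_ne _ _ _ _ (Ne.symm hi)] at this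
    obtain ⟨e, he⟩ := Hrow β A h hA j
    obtain ⟨f, hf⟩ := this
    rw [he] at hf
    exact ⟨f - e + c * e, by linear_combination hf⟩
  have hall := Hall β A hr hA
  have hβ : a ∣ β := by
    have := Hall _ _ (hr.trans (reach_move 1 β A)) (by simp [hA]) 2 2
    simp only [Matrix.add_apply, Matrix.single_apply_same, hA] at this
    obtain ⟨u, hu⟩ := hall 2 2
    obtain ⟨v, hv⟩ := hall 0 1
    obtain ⟨w, hw⟩ := this
    rw [hu, hv] at hw
    exact ⟨w - u + (A 1 1 - v * A 1 0), by linear_combination hw⟩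
  have hu : IsUnit a := by
    by_contra hn
    obtain ⟨p, hp, hpa⟩ := exists_prime_of_not_unit a hn
    obtain ⟨d1, d2⟩ := dvd_adj p A (fun i j => hpa.trans (hall i j))
    have := bad_of p β A (hpa.trans hβ) d1 d2
    obtain ⟨g, -, hg, hgx⟩ := hr
    rw [← hgx, Bad.iff hg] at this
    exact hx p hp this
  rcases Int.isUnit_iff.mp hu with rfl | rfl
  · exact ⟨β, A, hr, hA⟩
  · refine ⟨β, _, (hr.trans (reach_col 0 1 (by decide) (A 0 1 - 2) 1 β A)).trans
      (reach_col 1 0 (by decide) 1 1 β _), ?_⟩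
    rw [Matrix.mul_transvection_apply_same, Matrix.mul_transvection_apply_same,
        Matrix.mul_transvection_apply_of_ne _ _ _ _ (by decide), hA]
    ring

/-- Block matrices `1 ⊕ (b c; d e)`. -/
def blk (b c d e : ℤ) : MatZ := !![1, 0, 0; 0, b, c; 0, d, e]

theorem step2b (x : MZ) (h : ∃ β A, Reach x (1, β, A, 0) ∧ A 0 0 = 1) :
    ∃ β b c d e, Reach x (1, β, blk b c d e, 0) := by
  obtain ⟨β, A, hr, hA⟩ := h
  refine ⟨β, A 1 1 - A 1 0 * A 0 1, A 1 2 - A 1 0 * A 0 2, A 2 1 - A 2 0 * A 0 1,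
    A 2 2 - A 2 0 * A 0 2, hr.trans ?_⟩
  convert reach_mul !![1, 0, 0; -A 1 0, 1, 0; -A 2 0, 0, 1] !![1, -A 0 1, -A 0 2; 0, 1, 0; 0, 0, 1]
    (by simp [Matrix.det_fin_three]) (by simp [Matrix.det_fin_three]) 1 β A using 4
  ext i j
  fin_cases i <;> fin_cases j <;>
    simp [blk, Matrix.mul_apply, Fin.sum_univ_three, Matrix.vecMul, dotProduct, hA] <;> ring

theorem blk_op (x : MZ) (β b c d e p q r s p' q' r' s' : ℤ) (h : p * s - q * r = 1)
    (h' : p' * s' - q' * r' = 1) (hr : Reach x (1, β, blk b c d e, 0)) :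
    Reach x (1, β, blk ((p * b + q * d) * p' + (p * c + q * e) * r')
      ((p * b + q * d) * q' + (p * c + q * e) * s')
      ((r * b + s * d) * p' + (r * c + s * e) * r')
      ((r * b + s * d) * q' + (r * c + s * e) * s'), 0) := by
  refine hr.trans ?_
  convert reach_mul (blk p q r s) (blk p' q' r' s')
    (by simp [blk, Matrix.det_fin_three, h]) (by simp [blk, Matrix.det_fin_three, h'])
    1 β (blk b c d e) using 4
  ext i j
  fin_cases i <;> fin_cases j <;>
    simp [blk, Matrix.mul_apply, Fin.sum_univ_three]

theorem blk_move (x : MZ) (n β b c d e : ℤ) (hr : Reach x (1, β, blk b c d e, 0)) :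
    Reach x (1, β - 2 * (n * b), blk b c d (e + (β - n * b) * n), 0) := by
  refine hr.trans ?_
  convert reach_move n β (blk b c d e) using 3
  · simp [blk]
  · congr 1
    ext i j
    fin_cases i <;> fin_cases j <;> simp [blk]

theorem step3 (x : MZ) (hx : ∀ p : ℤ, Prime p → ¬ Bad p x)
    (h0 : ∃ β b c d e, Reach x (1, β, blk b c d e, 0)) :
    ∃ β c d e, Reach x (1, β, blk 1 c d e, 0) := by
  obtain ⟨β0, b0, c0, d0, e0, h0⟩ := h0
  obtain ⟨b, ⟨β, c, d, e, hr⟩, hmin⟩ := exists_dvd_min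
    (fun b => ∃ β c d e, Reach x (1, β, blk b c d e, 0)) ⟨b0, β0, c0, d0, e0, h0⟩
  have Hrow : ∀ β c d e, Reach x (1, β, blk b c d e, 0) → b ∣ c := by
    intro β c d e h
    refine min_dvd (fun b c => ∃ β d e, Reach x (1, β, blk b c d e, 0)) ?_ ?_ b c
      ⟨β, d, e, h⟩ ?_
    · rintro b c n ⟨β, d, e, h⟩
      have := blk_op x β b c d e 1 0 0 1 1 0 n 1 (by ring) (by ring) h
      refine ⟨β, d + n * e, e, ?_⟩
      convert this using 4
      congr 1 <;> ring
    · rintro b c n ⟨β, d, e, h⟩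
      have := blk_op x β b c d e 1 0 0 1 1 n 0 1 (by ring) (by ring) h
      refine ⟨β, d, e + n * d, ?_⟩
      convert this using 4
      congr 1 <;> ring
    · rintro g b' ⟨β, d, e, h⟩ hga
      exact hmin g ⟨β, _, d, e, h⟩ hga
  have Hcol : ∀ β c d e, Reach x (1, β, blk b c d e, 0) → b ∣ d := by
    intro β c d e h
    refine min_dvd (fun b d => ∃ β c e, Reach x (1, β, blk b c d e, 0)) ?_ ?_ b d
      ⟨β, c, e, h⟩ ?_
    · rintro b d n ⟨β, c, e, h⟩
      have := blk_op x β b c d e 1 n 0 1 1 0 0 1 (by ring) (by ring) h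
      refine ⟨β, c + n * e, e, ?_⟩
      convert this using 4
      congr 1 <;> ring
    · rintro b d n ⟨β, c, e, h⟩
      have := blk_op x β b c d e 1 0 n 1 1 0 0 1 (by ring) (by ring) h
      refine ⟨β, c, e + n * c, ?_⟩
      convert this using 4
      congr 1 <;> ring
    · rintro g b' ⟨β, c, e, h⟩ hga
      exact hmin g ⟨β, c, _, e, h⟩ hga
  have Hall : ∀ β c d e, Reach x (1, β, blk b c d e, 0) → b ∣ e := by
    intro β c d e h
    obtain ⟨d', hd'⟩ := Hcol β c d e h
    obtain ⟨c', hc'⟩ := Hrow β c d e h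
    have := blk_op x β b c d e (1 - d') 1 (-d') 1 1 0 0 1 (by ring) (by ring) h
    have h2 : Reach x (1, β, blk b ((1 - d') * c + e) (-d' * b + d) (-d' * c + e), 0) := by
      convert this using 4
      rw [hd']
      congr 1 <;> ring
    obtain ⟨f, hf⟩ := Hrow _ _ _ _ h2
    exact ⟨f - (1 - d') * c', by rw [hc'] at hf; linear_combination hf⟩
  have h1 := Hrow _ _ _ _ hr
  have h2 := Hcol _ _ _ _ hr
  have h3 := Hall _ _ _ _ hr
  have hβ : b ∣ β := by
    obtain ⟨f, hf⟩ := Hall _ _ _ _ (blk_move x 1 _ _ _ _ _ hr)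
    obtain ⟨f', hf'⟩ := h3
    exact ⟨f - f' + 1, by linear_combination hf - hf'⟩
  have hu : IsUnit b := by
    by_contra hn
    obtain ⟨p, hp, hpa⟩ := exists_prime_of_not_unit b hn
    have p1 := hpa.trans h1
    have p2 := hpa.trans h2
    have p3 := hpa.trans h3
    have := bad_of p β (blk b c d e) (hpa.trans hβ) (by
      have p4 : p ∣ b * e - c * d := dvd_sub (hpa.mul_right _) (p1.mul_right _)
      intro i j
      fin_cases i <;> fin_cases j <;> simp [blk, Matrix.adjugate_fin_three, *])
      (by
        have p4 : p ∣ b * e - c * d := dvd_sub (hpa.mul_right _) (p1.mul_right _)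
        simpa [blk, Matrix.det_fin_three] using p4)
    obtain ⟨g, -, hg, hgx⟩ := hr
    rw [← hgx, Bad.iff hg] at this
    exact hx p hp this
  rcases Int.isUnit_iff.mp hu with rfl | rfl
  · exact ⟨β, c, d, e, hr⟩
  · have a1 := blk_op x β (-1) c d e 1 0 0 1 (1 + (c - 2)) (c - 2) 1 1 (by ring) (by ring) hr
    rw [show (1 * -1 + 0 * d) * (1 + (c - 2)) + (1 * c + 0 * e) * 1 = 1 by ring] at a1
    exact ⟨β, _, _, _, a1⟩

theorem step4 (x : MZ) (h : ∃ β c d e, Reach x (1, β, blk 1 c d e, 0)) :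
    ∃ ε k, (ε = 0 ∨ ε = 1) ∧ Reach x (1, ε, Matrix.diagonal ![1, 1, k], 0) := by
  obtain ⟨β, c, d, e, hr⟩ := h
  have h1 := blk_op x β 1 c d e 1 0 (-d) 1 1 (-c) 0 1 (by ring) (by ring) hr
  have h2 : Reach x (1, β, blk 1 0 0 (e - d * c), 0) := by
    convert h1 using 4
    congr 1 <;> ring
  have h3 := blk_move x (β / 2) _ _ _ _ _ h2
  refine ⟨β % 2, e - d * c + (β - β / 2 * 1) * (β / 2), Int.emod_two_eq_zero_or_one β, ?_⟩
  convert h3 using 3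
  · omega
  · congr 1
    ext i j
    fin_cases i <;> fin_cases j <;> simp [blk]

theorem proj_cond (x : MZ) (hx : Projective x) :
    (∀ p : ℤ, Prime p → ¬ ∃ w : MZ, x = p • w) ∧ (∀ p : ℤ, Prime p → ¬ Bad p x) := by
  obtain ⟨g, hg, α, β, a₁, a₂, a₃, hgx, h0, -, d1, d2, d3, g1, g2, g3⟩ := hx
  have key : ∀ p u v w : ℤ, Int.gcd (Int.gcd u v) w = 1 → p ∣ u → p ∣ v → p ∣ w → p ∣ 1 := by
    intro p u v w h hu hv hw
    have := Int.dvd_coe_gcd (Int.dvd_coe_gcd hu hv) hw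
    rw [h] at this
    simpa using this
  have hα : α = 1 := by
    have := key α _ _ _ g1 (dvd_mul_right _ _) (dvd_mul_right _ _) (d2.mul_right _)
    exact Int.eq_one_of_dvd_one h0.le this
  subst hα
  simp only [one_mul] at g1 g2 g3
  constructor
  · rintro p hp ⟨w, rfl⟩
    rw [hg.1.map_smul] at hgx
    have e1 := congrArg Prod.fst hgx
    simp only [Prod.smul_fst, smul_eq_mul] at e1
    exact hp.not_isUnit (IsUnit.of_mul_eq_one _ e1)
  · intro p hp hb
    rw [← Bad.iff hg, hgx] at hb
    obtain ⟨hβ, hadj⟩ := of_bad p β hp _ hb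
    have k1 := hadj 0 0
    have k2 := hadj 1 1
    have k3 := hadj 2 2
    rw [Matrix.adjugate_fin_three] at k1 k2 k3
    simp at k1 k2 k3
    refine hp.not_isUnit (isUnit_of_dvd_one ?_)
    rcases hp.dvd_or_dvd k1 with h | h
    · exact key p _ _ _ g2 h hβ (by rwa [mul_comm])
    · exact key p _ _ _ g3 h hβ k3

end FreudenthalZ

/-- **Reduction Lemma II**: every projective element `x ∈ M_ℤ` is equivalent, under a
finite product of the elementary transformations, to `(1, ε, diag(1,1,k), 0)` with
`ε ∈ {0,1}` and `4k + ε² = q'(x)` (so `ε` and `k` are determined by `q'(x)`). -/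
theorem reduction_lemma_II (x : MZ) (hx : Projective x) :
    ∃ (g : MZ → MZ) (ε k : ℤ), ZWord g ∧ (ε = 0 ∨ ε = 1) ∧
      g x = (1, ε, Matrix.diagonal ![1, 1, k], 0) ∧ 4 * k + ε ^ 2 = qz x := by
  obtain ⟨h1, h2⟩ := proj_cond x hx
  obtain ⟨ε, k, hε, g, hg, hG, hgx⟩ :=
    step4 x (step3 x h2 (step2b x (step2 x h2 (step1 x h1))))
  refine ⟨g, ε, k, hg, hε, hgx, ?_⟩
  rw [← hG.2.2.1 x, hgx]
  simp [qz, tb, Fin.prod_univ_three]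
  ring
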